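/- arXiv:1207.0244 — 3 statements merged into one kernel-verified Lean document; each statement's English description precedes it below -/
import Mathlib

section
/- Let r = gcd(d_1, …, d_n) and let X′ ⊆ ℙ^{n−1} be the degenerate projective torus parameterized by x_1^{r v_1}, …, x_n^{r v_n}. Then the vanishing ideal I(X) is a complete intersection if and only if the vanishing ideal I(X′) is a complete intersection. -/
open MvPolynomial

namespace TwistCI

variable {K : Type} [Field K] {n : ℕ}

/-- homogeneous polynomials vanishing on the torus parameterized by `x_i ^ w_i` -/
def van (K : Type) [Field K] {n : ℕ} (w : Fin n → ℕ) : Set (MvPolynomial (Fin n) K) :=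
  {f | (∃ e, f.IsHomogeneous e) ∧ ∀ x : Fin n → Kˣ, eval (fun i => (x i : K) ^ w i) f = 0}

/-- remainder of an exponent vector -/
noncomputable def modE (r : ℕ) (a : Fin n →₀ ℕ) : Fin n →₀ ℕ := a.mapRange (· % r) (by simp)

/-- quotient of an exponent vector -/
noncomputable def divE (r : ℕ) (a : Fin n →₀ ℕ) : Fin n →₀ ℕ := a.mapRange (· / r) (by simp)

lemma modE_apply (r : ℕ) (a : Fin n →₀ ℕ) (i : Fin n) : modE r a i = a i % r := rfl

lemma divE_apply (r : ℕ) (a : Fin n →₀ ℕ) (i : Fin n) : divE r a i = a i / r := rfl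

lemma modE_add_divE (r : ℕ) (a : Fin n →₀ ℕ) : modE r a + r • divE r a = a := by
  ext i; simp [modE_apply, divE_apply, Nat.mod_add_div]

open Classical in
/-- projection of exponent vectors divisible by `r` -/
noncomputable def proj (r : ℕ) : MvPolynomial (Fin n) K →ₗ[K] MvPolynomial (Fin n) K :=
  (basisMonomials (Fin n) K).constr K
    (fun a => if modE r a = 0 then monomial (divE r a) (1 : K) else 0)

open Classical in
lemma proj_monomial (r : ℕ) (a : Fin n →₀ ℕ) (c : K) :
    proj r (monomial a c) = if modE r a = 0 then monomial (divE r a) c else 0 := by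
  have h1 : (monomial a c : MvPolynomial (Fin n) K) = c • (basisMonomials (Fin n) K a) := by
    simp [coe_basisMonomials, smul_monomial]
  rw [h1, map_smul, proj, Module.Basis.constr_basis]
  split_ifs <;> simp [smul_monomial]

lemma proj_mul_expand {r : ℕ} (hr : 0 < r) (p f : MvPolynomial (Fin n) K) :
    proj r (p * expand r f) = proj r p * f := by
  induction f using MvPolynomial.induction_on' with
  | add f g hf hg => rw [map_add, mul_add, map_add, hf, hg, mul_add]
  | monomial b c =>
    rw [expand_monomial]
    induction p using MvPolynomial.induction_on' with
    | monomial u a =>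
      rw [monomial_mul, proj_monomial, proj_monomial]
      have h1 : modE r (u + r • b) = modE r u := by
        ext i; simp [modE_apply]
      have h2 : divE r (u + r • b) = divE r u + b := by
        ext i; simp [divE_apply, Nat.add_mul_div_left _ _ hr]
      rw [h1, h2]
      split_ifs <;> simp [monomial_mul]
    | add p q hp hq => rw [add_mul, map_add, hp, hq, map_add, add_mul]

lemma proj_expand {r : ℕ} (hr : 0 < r) (f : MvPolynomial (Fin n) K) :
    proj r (expand r f) = f := by
  have h := proj_mul_expand hr 1 f
  rw [one_mul] at h
  rw [h]
  have h1 : (1 : MvPolynomial (Fin n) K) = monomial 0 1 := rfl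
  rw [h1, proj_monomial]
  have h2 : modE r (0 : Fin n →₀ ℕ) = 0 := by ext i; simp [modE_apply]
  have h3 : divE r (0 : Fin n →₀ ℕ) = 0 := by ext i; simp [divE_apply]
  rw [if_pos h2, h3, ← h1, one_mul]

lemma constantCoeff_proj {r : ℕ} (hr : 0 < r) (p : MvPolynomial (Fin n) K) :
    constantCoeff (proj r p) = constantCoeff p := by
  classical
  induction p using MvPolynomial.induction_on' with
  | monomial u a =>
    rw [proj_monomial]
    by_cases hu : u = 0
    · subst hu
      have h2 : modE r (0 : Fin n →₀ ℕ) = 0 := by ext i; simp [modE_apply]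
      have h3 : divE r (0 : Fin n →₀ ℕ) = 0 := by ext i; simp [divE_apply]
      rw [if_pos h2, h3]
    · split_ifs with h
      · have : divE r u ≠ 0 := by
          intro h0
          apply hu
          rw [← modE_add_divE r u, h, h0]; simp
        simp [constantCoeff_monomial, hu, this]
      · simp [constantCoeff_monomial, hu]
  | add p q hp hq => simp [hp, hq]

lemma van_monomial_mul {w : Fin n → ℕ} {f : MvPolynomial (Fin n) K} (hf : f ∈ van K w)
    (a : Fin n →₀ ℕ) (c : K) : monomial a c * f ∈ van K w := by
  obtain ⟨⟨e, he⟩, h⟩ := hf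
  refine ⟨⟨_, (isHomogeneous_monomial c rfl).mul he⟩, fun x => ?_⟩
  rw [map_mul, h x, mul_zero]

lemma span_mul_mem {w : Fin n → ℕ} {f : MvPolynomial (Fin n) K}
    (hf : f ∈ Submodule.span K (van K w)) (p : MvPolynomial (Fin n) K) :
    p * f ∈ Submodule.span K (van K w) := by
  induction p using MvPolynomial.induction_on' with
  | monomial u a =>
    induction hf using Submodule.span_induction with
    | mem x hx => exact Submodule.subset_span (van_monomial_mul hx u a)
    | zero => simp
    | add x y _ _ hx hy => rw [mul_add]; exact add_mem hx hy
    | smul c x _ hx => rw [mul_smul_comm]; exact Submodule.smul_mem _ _ hx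
  | add p q hp hq => rw [add_mul]; exact add_mem hp hq

lemma mem_ideal_iff {w : Fin n → ℕ} {f : MvPolynomial (Fin n) K} :
    f ∈ Ideal.span (van K w) ↔ f ∈ Submodule.span K (van K w) := by
  constructor
  · intro hf
    induction hf using Submodule.span_induction with
    | mem x hx => exact Submodule.subset_span hx
    | zero => simp
    | add x y _ _ hx hy => exact add_mem hx hy
    | smul c x _ hx => exact span_mul_mem hx c
  · intro hf
    induction hf using Submodule.span_induction with
    | mem x hx => exact Submodule.subset_span hx
    | zero => simp
    | add x y _ _ hx hy => exact add_mem hx hy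
    | smul c x _ hx => rw [smul_eq_C_mul]; exact Ideal.mul_mem_left _ _ hx

/-- the `K`-space `m * I` -/
noncomputable def mI (K : Type) [Field K] {n : ℕ} (w : Fin n → ℕ) : Submodule K (MvPolynomial (Fin n) K) :=
  Submodule.span K {f | ∃ i, ∃ q ∈ van K w, f = X i * q}

lemma X_mul_mem {w : Fin n → ℕ} {f : MvPolynomial (Fin n) K}
    (hf : f ∈ Submodule.span K (van K w)) (i : Fin n) : X i * f ∈ mI K w := by
  induction hf using Submodule.span_induction with
  | mem x hx => exact Submodule.subset_span ⟨i, x, hx, rfl⟩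
  | zero => simp
  | add x y _ _ hx hy => rw [mul_add]; exact add_mem hx hy
  | smul c x _ hx => rw [mul_smul_comm]; exact Submodule.smul_mem _ _ hx

lemma mul_mem_mI {w : Fin n → ℕ} {f p : MvPolynomial (Fin n) K}
    (hf : f ∈ Ideal.span (van K w)) (hp : constantCoeff p = 0) : p * f ∈ mI K w := by
  have hp' : p ∈ Ideal.span (X '' (Set.univ : Set (Fin n)) : Set (MvPolynomial (Fin n) K)) := by
    rw [mem_ideal_span_X_image]
    intro m hm
    by_contra! hcon
    have : m = 0 := by ext i; simpa using hcon i (Set.mem_univ i)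
    subst this
    rw [mem_support_iff] at hm
    exact hm hp
  clear hp
  revert f
  induction hp' using Submodule.span_induction with
  | mem x hx =>
    intro f hf
    obtain ⟨i, -, rfl⟩ := hx
    exact X_mul_mem (mem_ideal_iff.1 hf) i
  | zero => simp
  | add x y _ _ hx hy => intro f hf; rw [add_mul]; exact add_mem (hx hf) (hy hf)
  | smul c x _ hx =>
    intro f hf
    have : c • x * f = x * (c * f) := by rw [smul_eq_mul]; ring
    rw [this]
    exact hx (Ideal.mul_mem_left _ _ hf)

/-- if `I` is generated by the image of `I'`, then `m I` projects to `m' I'` -/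
lemma proj_mem_mI {r : ℕ} (hr : 0 < r) {w : Fin n → ℕ} {q : MvPolynomial (Fin n) K}
    (hq : q ∈ (Ideal.span (van K w)).map (expand r : _ →ₐ[K] MvPolynomial (Fin n) K)) :
    ∀ p : MvPolynomial (Fin n) K, constantCoeff p = 0 → proj r (p * q) ∈ mI K w := by
  induction hq using Submodule.span_induction with
  | mem x hx =>
    intro p hp
    obtain ⟨f, hf, rfl⟩ := hx
    have := proj_mul_expand hr p f
    change proj r (p * expand r f) ∈ _
    rw [this]
    exact mul_mem_mI hf (by rw [constantCoeff_proj hr, hp])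
  | zero => simp
  | add x y _ _ hx hy => intro p hp; rw [mul_add, map_add]; exact add_mem (hx p hp) (hy p hp)
  | smul c x _ hx =>
    intro p hp
    have : p * (c • x) = (p * c) * x := by rw [smul_eq_mul]; ring
    rw [this]
    exact hx _ (by rw [map_mul, hp, zero_mul])

/-- graded Nakayama -/
lemma nakayama {w : Fin n → ℕ} {m : ℕ} (h : Fin m → MvPolynomial (Fin n) K)
    (hh : ∀ j, h j ∈ van K w)
    (hs : ∀ f ∈ van K w, ∃ c : Fin m → K, f - ∑ j, c j • h j ∈ mI K w) :
    Ideal.span (van K w) = Ideal.span (Set.range h) := by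
  apply le_antisymm
  · have key : ∀ e : ℕ, ∀ f ∈ van K w, f.IsHomogeneous e → f ∈ Ideal.span (Set.range h) := by
      intro e
      induction e using Nat.strong_induction_on with
      | _ e ih =>
        intro f hf hfe
        obtain ⟨c, hc⟩ := hs f hf
        have hw : ∀ u ∈ mI K w, homogeneousComponent e u ∈ Ideal.span (Set.range h) := by
          intro u hu
          induction hu using Submodule.span_induction with
          | mem x hx =>
            obtain ⟨i, q, hq, rfl⟩ := hx
            obtain ⟨e', he'⟩ := hq.1
            have hom : (X i * q).IsHomogeneous (1 + e') := (isHomogeneous_X K i).mul he'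
            rw [homogeneousComponent_of_mem hom]
            split_ifs with hee
            · exact Ideal.mul_mem_left _ _ (ih e' (by omega) q hq he')
            · simp
          | zero => simp
          | add x y _ _ hx hy => rw [map_add]; exact add_mem hx hy
          | smul c x _ hx =>
            rw [map_smul, smul_eq_C_mul]; exact Ideal.mul_mem_left _ _ hx
        have h1 := hw _ hc
        rw [map_sub, homogeneousComponent_of_mem hfe, if_pos rfl] at h1
        have h2 : homogeneousComponent e (∑ j, c j • h j) ∈ Ideal.span (Set.range h) := by
          rw [map_sum]
          refine Ideal.sum_mem _ fun j _ => ?_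
          obtain ⟨e', he'⟩ := (hh j).1
          rw [map_smul, homogeneousComponent_of_mem he', smul_eq_C_mul]
          refine Ideal.mul_mem_left _ _ ?_
          split_ifs
          · exact Ideal.subset_span ⟨j, rfl⟩
          · simp
        simpa using add_mem h1 h2
    rw [Ideal.span_le]
    intro f hf
    obtain ⟨e, he⟩ := hf.1
    exact key e f hf he
  · rw [Ideal.span_le]
    rintro _ ⟨j, rfl⟩
    exact Ideal.subset_span (hh j)

lemma backward {r : ℕ} (hr : 0 < r) {w : Fin n → ℕ} {k : ℕ}
    (g : Fin k → MvPolynomial (Fin n) K)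
    (hg : (Ideal.span (van K w)).map (expand r : _ →ₐ[K] MvPolynomial (Fin n) K)
      = Ideal.span (Set.range g)) :
    ∃ g' : Fin k → MvPolynomial (Fin n) K,
      Ideal.span (van K w) = Ideal.span (Set.range g') := by
  classical
  let Q := (mI K w).mkQ
  let G : Fin k → _ := fun j => Q (proj r (g j))
  have hle : Submodule.span K (Q '' van K w) ≤ Submodule.span K (Set.range G) := by
    rw [Submodule.span_le]
    rintro _ ⟨f, hf, rfl⟩
    have hfm : expand r f ∈ Ideal.span (Set.range g) := by
      rw [← hg]; exact Ideal.mem_map_of_mem _ (Ideal.subset_span hf)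
    obtain ⟨s, hs⟩ := Ideal.mem_span_range_iff_exists_fun.1 hfm
    have hQ : Q f = ∑ j, constantCoeff (s j) • G j := by
      rw [← proj_expand hr f, ← hs, map_sum, map_sum]
      refine Finset.sum_congr rfl fun j _ => ?_
      have hgj : g j ∈ (Ideal.span (van K w)).map (expand r : _ →ₐ[K] MvPolynomial (Fin n) K) := by
        rw [hg]; exact Ideal.subset_span ⟨j, rfl⟩
      have h1 := proj_mem_mI hr hgj (s j - C (constantCoeff (s j))) (by simp)
      rw [sub_mul, map_sub, ← smul_eq_C_mul, map_smul] at h1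
      have h2 := (Submodule.Quotient.eq (mI K w)).2 h1
      exact h2
    rw [SetLike.mem_coe, hQ]
    exact Submodule.sum_mem _ fun j _ => Submodule.smul_mem _ _ (Submodule.subset_span ⟨j, rfl⟩)
  have : Module.Finite K (Submodule.span K (Set.range G)) :=
    Module.Finite.span_of_finite K (Set.finite_range G)
  have : Module.Finite K (Submodule.span K (Q '' van K w)) :=
    Submodule.finiteDimensional_of_le hle
  have hcard : Module.finrank K (Submodule.span K (Q '' van K w)) ≤ k := by
    refine (Submodule.finrank_mono hle).trans ?_
    have h5 := finrank_range_le_card (R := K) G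
    rw [Fintype.card_fin] at h5
    exact h5
  obtain ⟨f, hf, hspan, -⟩ := Submodule.exists_fun_fin_finrank_span_eq K (Q '' van K w)
  choose h hh hQh using hf
  have hnak := nakayama (w := w) h hh (by
    intro p hp
    have : Q p ∈ Submodule.span K (Set.range f) := by
      rw [hspan]; exact Submodule.subset_span ⟨p, hp, rfl⟩
    obtain ⟨c, hc⟩ := (Submodule.mem_span_range_iff_exists_fun K).1 this
    refine ⟨c, ?_⟩
    refine (Submodule.Quotient.eq (mI K w)).1 ?_
    change Q p = Q _
    rw [← hc, map_sum]
    exact Finset.sum_congr rfl fun j _ => by rw [map_smul, hQh])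
  refine ⟨fun i => if hi : i.1 < _ then h ⟨i.1, hi⟩ else 0, ?_⟩
  rw [hnak]
  apply le_antisymm
  · rw [Ideal.span_le]
    rintro _ ⟨j, rfl⟩
    refine Ideal.subset_span ⟨⟨j.1, j.2.trans_le hcard⟩, ?_⟩
    simp
  · rw [Ideal.span_le]
    rintro _ ⟨i, rfl⟩
    dsimp only
    split_ifs
    · exact Ideal.subset_span ⟨_, rfl⟩
    · simp

/-- the part of `f` with exponents congruent to `ρ` modulo `r` -/
noncomputable def part (r : ℕ) (ρ : Fin n →₀ ℕ) (f : MvPolynomial (Fin n) K) :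
    MvPolynomial (Fin n) K :=
  ∑ a ∈ f.support with modE r a = ρ, monomial (divE r a) (coeff a f)

lemma eq_sum_part (r : ℕ) (f : MvPolynomial (Fin n) K) :
    f = ∑ ρ ∈ f.support.image (modE r), monomial ρ 1 * expand r (part r ρ f) := by
  conv_lhs => rw [f.as_sum]
  rw [← Finset.sum_fiberwise_of_maps_to (g := modE r) (t := f.support.image (modE r))
    (fun a ha => Finset.mem_image_of_mem _ ha)]
  refine Finset.sum_congr rfl fun ρ _ => ?_
  rw [part, map_sum, Finset.mul_sum]
  refine Finset.sum_congr rfl fun a ha => ?_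
  rw [expand_monomial, monomial_mul, one_mul, ← (Finset.mem_filter.1 ha).2, modE_add_divE]

lemma part_homogeneous {r : ℕ} (hr : 0 < r) (ρ : Fin n →₀ ℕ) {f : MvPolynomial (Fin n) K} {e : ℕ}
    (hf : f.IsHomogeneous e) : (part r ρ f).IsHomogeneous ((e - ρ.degree) / r) := by
  refine IsHomogeneous.sum _ _ _ fun a ha => isHomogeneous_monomial _ ?_
  obtain ⟨ha, haρ⟩ := Finset.mem_filter.1 ha
  have h1 : a.degree = e := by
    have := hf (mem_support_iff.1 ha)
    rwa [Finsupp.degree_eq_weight_one]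
  have h2 := congrArg Finsupp.degree (modE_add_divE r a)
  rw [map_add, haρ, h1, map_nsmul, smul_eq_mul] at h2
  rw [← h2, Nat.add_sub_cancel_left, Nat.mul_div_cancel_left _ hr]

lemma part_vanish {r : ℕ} (hr : 0 < r) (ρ : Fin n →₀ ℕ) {f : MvPolynomial (Fin n) K}
    {v : Fin n → ℕ} (z : Fin n → Kˣ) (hz : ∀ i, orderOf (z i ^ v i) = r)
    (hf : ∀ x : Fin n → Kˣ, eval (fun i => (x i : K) ^ v i) f = 0) (x : Fin n → Kˣ) :
    eval (fun i => (x i : K) ^ (r * v i)) (part r ρ f) = 0 := by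
  classical
  set y : Fin n → K := fun i => (x i : K) ^ v i with hy
  let P : MvPolynomial (Fin n) K :=
    ∑ a ∈ f.support, monomial (modE r a) (coeff a f * ∏ i, y i ^ a i)
  let S : Fin n → Finset K := fun i =>
    (Finset.range r).image (fun k => (((z i ^ v i) ^ k : Kˣ) : K))
  have hS : ∀ i, (S i).card = r := by
    intro i
    rw [Finset.card_image_of_injOn, Finset.card_range]
    intro a ha b hb hab
    have hab' : (z i ^ v i) ^ a = (z i ^ v i) ^ b := Units.ext hab
    refine pow_injOn_Iio_orderOf ?_ ?_ hab'
    · rw [hz]; simpa using ha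
    · rw [hz]; simpa using hb
  have hP : P = 0 := by
    refine eq_zero_of_eval_zero_at_prod_finset P S ?_ ?_
    · intro i
      rw [hS, degreeOf_lt_iff hr]
      intro m hm
      obtain ⟨a, -, ha⟩ := Finset.mem_biUnion.1 (support_sum hm)
      have := Finset.mem_singleton.1 (support_monomial_subset ha)
      rw [this]
      simpa [modE_apply] using Nat.mod_lt _ hr
    · intro u hu
      have : ∀ i, ∃ k, u i = (((z i ^ v i) ^ k : Kˣ) : K) := by
        intro i
        obtain ⟨k, -, hk⟩ := Finset.mem_image.1 (hu i)
        exact ⟨k, hk.symm⟩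
      choose k hk using this
      have h0 := hf (fun i => x i * z i ^ k i)
      rw [eval_eq'] at h0
      rw [map_sum, ← h0]
      refine Finset.sum_congr rfl fun a _ => ?_
      rw [eval_monomial, mul_assoc, Finsupp.prod_fintype _ _ (by simp), ← Finset.prod_mul_distrib]
      congr 1
      refine Finset.prod_congr rfl fun i _ => ?_
      have h1 : u i ^ r = 1 := by
        rw [hk, ← Units.val_pow_eq_pow_val, ← pow_mul, mul_comm, pow_mul, ← hz i,
          pow_orderOf_eq_one]
        simp
      have h2 : u i ^ (modE r a i) = u i ^ a i := by
        conv_rhs => rw [← Nat.mod_add_div (a i) r, pow_add, pow_mul, h1, one_pow, mul_one]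
        simp [modE_apply]
      rw [h2, ← mul_pow]
      congr 1
      rw [hk, hy]
      push_cast
      rw [mul_pow, ← pow_mul, ← pow_mul, mul_comm (v i)]
  have hc := congrArg (coeff ρ) hP
  rw [coeff_sum, coeff_zero] at hc
  simp only [coeff_monomial] at hc
  rw [← Finset.sum_filter] at hc
  have hprod : (∏ i, y i ^ ρ i) ≠ 0 :=
    Finset.prod_ne_zero_iff.2 fun i _ => pow_ne_zero _ (pow_ne_zero _ (x i).ne_zero)
  refine (mul_eq_zero.1 (?_ : (∏ i, y i ^ ρ i) * _ = 0)).resolve_left hprod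
  rw [← hc, part, map_sum, Finset.mul_sum]
  refine Finset.sum_congr rfl fun a ha => ?_
  rw [eval_monomial, Finsupp.prod_fintype _ _ (by simp), mul_left_comm, ← Finset.prod_mul_distrib]
  congr 1
  refine Finset.prod_congr rfl fun i _ => ?_
  rw [← (Finset.mem_filter.1 ha).2]
  conv_rhs => rw [← modE_add_divE r a]
  simp only [hy, Finsupp.add_apply, Finsupp.smul_apply, smul_eq_mul, pow_add]
  ring

lemma ideal_eq_map {r : ℕ} (hr : 0 < r) {v : Fin n → ℕ} (z : Fin n → Kˣ)
    (hz : ∀ i, orderOf (z i ^ v i) = r) :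
    Ideal.span (van K v) = (Ideal.span (van K (fun i => r * v i))).map
      (expand r : _ →ₐ[K] MvPolynomial (Fin n) K) := by
  apply le_antisymm
  · rw [Ideal.span_le]
    rintro f ⟨⟨e, he⟩, hf⟩
    rw [SetLike.mem_coe, eq_sum_part r f]
    refine Ideal.sum_mem _ fun ρ _ => Ideal.mul_mem_left _ _ (Ideal.mem_map_of_mem _ ?_)
    exact Ideal.subset_span ⟨⟨_, part_homogeneous hr ρ he⟩, part_vanish hr ρ z hz hf⟩
  · rw [Ideal.map_span, Ideal.span_le]
    rintro _ ⟨f, ⟨⟨e, he⟩, hf⟩, rfl⟩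
    refine Ideal.subset_span ⟨⟨r * e, ?_⟩, fun x => ?_⟩
    · change (expand r f).IsHomogeneous (r * e)
      rw [f.as_sum, map_sum]
      refine IsHomogeneous.sum _ _ _ fun a ha => ?_
      rw [expand_monomial]
      refine isHomogeneous_monomial _ ?_
      have := he (mem_support_iff.1 ha)
      rw [map_nsmul, smul_eq_mul, Finsupp.degree_eq_weight_one]
      exact congrArg _ this
    · change eval _ (expand r f) = 0
      rw [eval_expand, ← hf x]
      congr 2
      funext i
      simp [← pow_mul, mul_comm]

end TwistCI



/-- **Proposition.** Let `K = 𝔽_q`, `β` a generator of `Kˣ`, `d i = orderOf (β ^ v i)` and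
`r = gcd(d 1, …, d n)`.  Let `IX` be the vanishing ideal of the degenerate projective
torus parameterized by `x_i ^ v_i`, and `IX'` that of the degenerate projective torus
parameterized by `x_i ^ (r * v i)`.  Then `IX` is a complete intersection (generated by
`n - 1 = ht IX` elements) if and only if `IX'` is a complete intersection. -/
theorem ci_iff_ci_of_gcd_twist
    (K : Type) [Field K] [Fintype K] (n : ℕ) (hn : 2 ≤ n)
    (v : Fin n → ℕ) (hv : ∀ i, 0 < v i)
    (β : Kˣ) (hβ : ∀ x : Kˣ, x ∈ Subgroup.zpowers β)
    (d : Fin n → ℕ) (hd : ∀ i, d i = orderOf (β ^ v i))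
    (r : ℕ) (hr : r = Finset.univ.gcd d)
    (IX : Ideal (MvPolynomial (Fin n) K))
    (hIX : IX = Ideal.span {f : MvPolynomial (Fin n) K |
      (∃ e, f.IsHomogeneous e) ∧
      ∀ x : Fin n → Kˣ, eval (fun i => (x i : K) ^ v i) f = 0})
    (IX' : Ideal (MvPolynomial (Fin n) K))
    (hIX' : IX' = Ideal.span {f : MvPolynomial (Fin n) K |
      (∃ e, f.IsHomogeneous e) ∧
      ∀ x : Fin n → Kˣ, eval (fun i => (x i : K) ^ (r * v i)) f = 0}) :
    (∃ g : Fin (n - 1) → MvPolynomial (Fin n) K, IX = Ideal.span (Set.range g)) ↔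
    (∃ g : Fin (n - 1) → MvPolynomial (Fin n) K, IX' = Ideal.span (Set.range g)) := by
  classical
  have hpos : ∀ i, 0 < d i := fun i => by rw [hd]; exact orderOf_pos _
  have hdvd : ∀ i, r ∣ d i := fun i => by rw [hr]; exact Finset.gcd_dvd (Finset.mem_univ i)
  have i0 : Fin n := ⟨0, by omega⟩
  have hr0 : 0 < r := Nat.pos_of_dvd_of_pos (hdvd i0) (hpos i0)
  have hz : ∀ i, orderOf ((β ^ (d i / r)) ^ v i) = r := by
    intro i
    obtain ⟨k, hk⟩ := hdvd i
    have hk0 : k ≠ 0 := by rintro rfl; have := hpos i; omega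
    have hdiv : d i / r = k := by rw [hk, Nat.mul_div_cancel_left _ hr0]
    rw [hdiv, ← pow_mul, mul_comm, pow_mul, orderOf_pow_of_dvd hk0 (by rw [← hd, hk]; simp),
      ← hd, hk, Nat.mul_div_cancel _ (Nat.pos_of_ne_zero hk0)]
  have key := TwistCI.ideal_eq_map hr0 (fun i => β ^ (d i / r)) hz
  have hIX1 : IX = Ideal.span (TwistCI.van K v) := hIX
  have hIX2 : IX' = Ideal.span (TwistCI.van K (fun i => r * v i)) := hIX'
  constructor
  · rintro ⟨g, hg⟩
    rw [hIX2]
    exact TwistCI.backward hr0 g (by rw [← key, ← hIX1, hg])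
  · rintro ⟨g, hg⟩
    refine ⟨fun i => expand r (g i), ?_⟩
    rw [hIX1, key, ← hIX2, hg, Ideal.map_span, ← Set.range_comp]
    rfl
end

section
/- The affine degenerate torus X* = {(x_1^{v_1}, …, x_n^{v_n}) : x_i ∈ K^* for all i} ⊆ K^n has cardinality |X*| = d_1 ⋯ d_n, and the degenerate projective torus X has cardinality |X| = d_1 ⋯ d_n / gcd(d_1, …, d_n); consequently deg(S/I(X)) = d_1 ⋯ d_n / gcd(d_1, …, d_n). -/
open MvPolynomial

lemma aux_eval_smul {K : Type} [Field K] {n m : ℕ} {f : MvPolynomial (Fin n) K}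
    (hf : f.IsHomogeneous m) (c : K) (x : Fin n → K) :
    eval (c • x) f = c ^ m * eval x f := by
  rw [eval_eq', eval_eq', Finset.mul_sum]
  refine Finset.sum_congr rfl fun e he => ?_
  have h1 : e.degree = m := by
    by_contra h
    exact (mem_support_iff.1 he) (hf.coeff_eq_zero h)
  have h2 : ∑ i, e i = m := by rw [← h1, Finsupp.degree_eq_sum]
  simp only [Pi.smul_apply, smul_eq_mul, mul_pow, Finset.prod_mul_distrib,
    Finset.prod_pow_eq_pow_sum, h2]
  ring

lemma aux_range_card {U : Type} [CommGroup U] [Finite U] (β : U)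
    (hβ : ∀ x : U, x ∈ Subgroup.zpowers β) (v : ℕ) :
    Nat.card (powMonoidHom v : U →* U).range = orderOf (β ^ v) := by
  have : IsCyclic U := ⟨β, hβ⟩
  rw [IsCyclic.card_powMonoidHom_range, orderOf_pow, orderOf_eq_card_of_forall_mem_zpowers hβ]

lemma aux_range_eq {U : Type} [CommGroup U] [Finite U] (β : U)
    (hβ : ∀ x : U, x ∈ Subgroup.zpowers β) (v : ℕ) :
    (powMonoidHom v : U →* U).range = (powMonoidHom (orderOf (β ^ v)) : U →* U).ker := by
  have : IsCyclic U := ⟨β, hβ⟩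
  apply Subgroup.eq_of_le_of_card_ge
  · rintro _ ⟨y, rfl⟩
    obtain ⟨k, rfl⟩ := hβ y
    rw [MonoidHom.mem_ker]
    simp only [powMonoidHom_apply]
    rw [← zpow_natCast (β ^ k), ← zpow_mul, mul_comm, zpow_mul, zpow_natCast, ← zpow_natCast,
      ← zpow_mul, mul_comm, zpow_mul, zpow_natCast, pow_orderOf_eq_one, one_zpow]
  · rw [aux_range_card β hβ, IsCyclic.card_powMonoidHom_ker,
      Nat.gcd_eq_right (orderOf_dvd_natCard _)]

lemma aux_pow_gcd {U ι : Type} [CommGroup U] (s : Finset ι) (d : ι → ℕ) (c : U) :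
    c ^ (s.gcd d) = 1 ↔ ∀ i ∈ s, c ^ d i = 1 := by
  simp only [← orderOf_dvd_iff_pow_eq_one, Finset.dvd_gcd_iff]

lemma aux_surj {K : Type} [Field K] {n : ℕ} (X : Set (Projectivization K (Fin n → K)))
    [Finite X] (i0 : Fin n) (hX : ∀ P ∈ X, P.rep i0 ≠ 0) (m : ℕ) (hm : Nat.card X ≤ m)
    (g : X → K) :
    ∃ f ∈ homogeneousSubmodule (Fin n) K m, ∀ P : X, eval P.1.rep f = g P := by
  classical
  have := Fintype.ofFinite X
  have hl : ∀ P Q : X, ∃ l : MvPolynomial (Fin n) K, l.IsHomogeneous 1 ∧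
      eval Q.1.rep l = 0 ∧ (P ≠ Q → eval P.1.rep l ≠ 0) := by
    intro P Q
    by_cases hPQ : P = Q
    · exact ⟨0, isHomogeneous_zero _ _ _, by simp, fun h => absurd hPQ h⟩
    have : ∃ i, Q.1.rep i0 * P.1.rep i ≠ Q.1.rep i * P.1.rep i0 := by
      by_contra! h
      apply hPQ
      apply Subtype.ext
      rw [← P.1.mk_rep, ← Q.1.mk_rep, Projectivization.mk_eq_mk_iff']
      refine ⟨P.1.rep i0 / Q.1.rep i0, ?_⟩
      ext i
      have := hX Q.1 Q.2
      have := h i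
      simp only [Pi.smul_apply, smul_eq_mul]
      field_simp
      linear_combination -this
    obtain ⟨i, hi⟩ := this
    refine ⟨C (Q.1.rep i0) * MvPolynomial.X i - C (Q.1.rep i) * MvPolynomial.X i0, ?_, ?_, ?_⟩
    · exact ((isHomogeneous_X K i).C_mul _).sub ((isHomogeneous_X K i0).C_mul _)
    · simp; ring
    · intro _
      simpa [sub_eq_zero] using hi
  choose l hl1 hl2 hl3 using hl
  let F : X → MvPolynomial (Fin n) K := fun P =>
    (∏ Q ∈ Finset.univ.erase P, l P Q) * MvPolynomial.X i0 ^ (m - (Finset.univ.erase P).card)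
  have hF1 : ∀ P, (F P).IsHomogeneous m := by
    intro P
    have h1 := IsHomogeneous.prod (Finset.univ.erase P) (l P) (fun _ => 1) (fun Q _ => hl1 P Q)
    have h2 := h1.mul ((isHomogeneous_X K i0).pow (m - (Finset.univ.erase P).card))
    convert h2 using 1
    have : (Finset.univ.erase P).card ≤ m :=
      (Finset.card_le_univ _).trans (by rwa [← Nat.card_eq_fintype_card])
    simp only [Finset.sum_const, smul_eq_mul]
    omega
  have hF2 : ∀ P Q, P ≠ Q → eval Q.1.rep (F P) = 0 := by
    intro P Q h
    simp only [F, map_mul, map_prod]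
    rw [Finset.prod_eq_zero (i := Q) (by simp [h.symm]) (hl2 P Q), zero_mul]
  have hF3 : ∀ P, eval P.1.rep (F P) ≠ 0 := by
    intro P
    simp only [F, map_mul, map_prod, map_pow, eval_X]
    refine mul_ne_zero (Finset.prod_ne_zero_iff.2 fun Q hQ => hl3 P Q ?_) (pow_ne_zero _ (hX P.1 P.2))
    exact (Finset.ne_of_mem_erase hQ).symm
  refine ⟨∑ P, C (g P / eval P.1.rep (F P)) * F P, ?_, ?_⟩
  · refine Submodule.sum_mem _ fun P _ => ?_
    exact (hF1 P).C_mul _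
  · intro P
    rw [map_sum, Finset.sum_eq_single P]
    · simp [hF3 P]
    · intro Q _ hQ
      simp [hF2 Q P hQ]
    · simp

/-- **Lemma.** Let `K = 𝔽_q`, `β` a generator of `Kˣ`, `v i > 0`, `d i = orderOf (β ^ v i)`.
The affine degenerate torus `X* = {(x_1^{v_1}, …, x_n^{v_n}) : x_i ∈ Kˣ} ⊆ Kⁿ` has
cardinality `d 1 ⋯ d n`, and the degenerate projective torus
`X = {[(x_1^{v_1}, …, x_n^{v_n})]} ⊆ ℙ^{n-1}` has cardinality
`d 1 ⋯ d n / gcd(d 1, …, d n)`; consequently the degree of `S/I(X)` — the constant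
value, i.e. the degree-`0` coefficient, of the Hilbert polynomial `p` of `S/I(X)` —
equals `d 1 ⋯ d n / gcd(d 1, …, d n)`. -/
theorem card_degenerate_torus_and_degree
    (K : Type) [Field K] [Fintype K] (n : ℕ) (hn : 2 ≤ n)
    (v : Fin n → ℕ) (hv : ∀ i, 0 < v i)
    (β : Kˣ) (hβ : ∀ x : Kˣ, x ∈ Subgroup.zpowers β)
    (d : Fin n → ℕ) (hd : ∀ i, d i = orderOf (β ^ v i))
    (Xaff : Set (Fin n → K))
    (hXaff : Xaff = {x | ∃ y : Fin n → Kˣ, x = fun i => (y i : K) ^ v i})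
    (Xproj : Set (Projectivization K (Fin n → K)))
    (hXproj : Xproj = {p | ∃ y : Fin n → Kˣ,
      ∃ hy : (fun i => (y i : K) ^ v i) ≠ 0,
      p = Projectivization.mk K (fun i => (y i : K) ^ v i) hy})
    (IX : Ideal (MvPolynomial (Fin n) K))
    (hIX : IX = Ideal.span {f : MvPolynomial (Fin n) K |
      (∃ e, f.IsHomogeneous e) ∧
      ∀ x : Fin n → Kˣ, eval (fun i => (x i : K) ^ v i) f = 0})
    (H : ℕ → ℕ)
    (hH : ∀ m, H m = Module.finrank K
      ((homogeneousSubmodule (Fin n) K m) ⧸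
        Submodule.comap (homogeneousSubmodule (Fin n) K m).subtype
          (Submodule.restrictScalars K IX)))
    (p : Polynomial ℚ)
    (hp : ∃ N : ℕ, ∀ m : ℕ, N ≤ m → (H m : ℚ) = p.eval (m : ℚ)) :
    Nat.card Xaff = ∏ i, d i ∧
    Nat.card Xproj = (∏ i, d i) / Finset.univ.gcd d ∧
    p.coeff 0 = (((∏ i, d i) / Finset.univ.gcd d : ℕ) : ℚ) := by
  classical
  let G : Fin n → Subgroup Kˣ := fun i => (powMonoidHom (v i) : Kˣ →* Kˣ).range
  have hG : ∀ i, Nat.card (G i) = d i := fun i => by rw [hd]; exact aux_range_card β hβ (v i)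
  have hG' : ∀ i c, c ∈ G i ↔ c ^ d i = 1 := fun i c => by
    rw [hd]; simp only [G]; rw [aux_range_eq β hβ (v i)]; rfl
  let GG : Subgroup (Fin n → Kˣ) := Subgroup.pi Set.univ G
  have hmem : ∀ y : Fin n → Kˣ, (fun i => y i ^ v i) ∈ GG := fun y i _ => ⟨y i, rfl⟩
  have hmem' : ∀ g ∈ GG, ∃ y : Fin n → Kˣ, g = fun i => y i ^ v i := by
    intro g hg
    have : ∀ i, ∃ y : Kˣ, y ^ v i = g i := fun i => hg i trivial
    choose y hy using this
    exact ⟨y, funext fun i => (hy i).symm⟩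
  have hGG : Nat.card GG = ∏ i, d i := by
    have e : GG ≃ ∀ i, G i := Equiv.Set.univPi fun i => (G i : Set Kˣ)
    rw [Nat.card_congr e, Nat.card_pi]
    exact Finset.prod_congr rfl fun i _ => hG i
  let i0 : Fin n := ⟨0, by omega⟩
  let co : (Fin n → Kˣ) → Fin n → K := fun g i => (g i : K)
  have hco : Function.Injective co := fun a b h => funext fun i => Units.ext (congrFun h i)
  have hco0 : ∀ g, co g ≠ 0 := fun g h => (g i0).ne_zero (congrFun h i0)
  have hcopow : ∀ y : Fin n → Kˣ, (fun i => (y i : K) ^ v i) = co (fun i => y i ^ v i) := by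
    intro y; ext i; simp [co]
  have h1 : Nat.card Xaff = ∏ i, d i := by
    have : Xaff = co '' (GG : Set (Fin n → Kˣ)) := by
      rw [hXaff]
      ext x
      constructor
      · rintro ⟨y, rfl⟩
        exact ⟨_, hmem y, (hcopow y).symm⟩
      · rintro ⟨g, hg, rfl⟩
        obtain ⟨y, rfl⟩ := hmem' g hg
        exact ⟨y, (hcopow y).symm⟩
    rw [this, Nat.card_image_of_injective hco]
    exact hGG
  have hXp : ∀ P, P ∈ Xproj ↔ ∃ g ∈ GG, P = Projectivization.mk K (co g) (hco0 g) := by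
    intro P
    rw [hXproj]
    constructor
    · rintro ⟨y, hy, rfl⟩
      exact ⟨_, hmem y, by congr 1⟩
    · rintro ⟨g, hg, rfl⟩
      obtain ⟨y, rfl⟩ := hmem' g hg
      exact ⟨y, by rw [hcopow]; exact hco0 _, by congr 1⟩
  let dg : Kˣ →* (Fin n → Kˣ) := Pi.constMonoidHom (Fin n) Kˣ
  let N : Subgroup GG := (dg.range).subgroupOf GG
  have hN : Nat.card N = Finset.univ.gcd d := by
    have : IsCyclic Kˣ := ⟨β, hβ⟩
    have hdiv : Finset.univ.gcd d ∣ Nat.card Kˣ :=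
      (Finset.gcd_dvd (Finset.mem_univ i0)).trans (by rw [hd]; exact orderOf_dvd_natCard _)
    have hk : Nat.card (powMonoidHom (Finset.univ.gcd d) : Kˣ →* Kˣ).ker = Finset.univ.gcd d := by
      rw [IsCyclic.card_powMonoidHom_ker, Nat.gcd_eq_right hdiv]
    rw [← hk]
    have hc : ∀ c : Kˣ, c ∈ (powMonoidHom (Finset.univ.gcd d) : Kˣ →* Kˣ).ker ↔ dg c ∈ GG := by
      intro c
      rw [MonoidHom.mem_ker, powMonoidHom_apply, aux_pow_gcd]
      constructor
      · intro h i _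
        exact (hG' i c).2 (h i (Finset.mem_univ i))
      · intro h i _
        exact (hG' i c).1 (h i trivial)
    symm
    refine Nat.card_congr (Equiv.ofBijective
      (fun c => (⟨⟨dg c.1, (hc c.1).1 c.2⟩, ⟨c.1, rfl⟩⟩ : N)) ⟨?_, ?_⟩)
    · intro a b h
      have h' : dg a.1 = dg b.1 := congrArg (fun z : N => z.1.1) h
      exact Subtype.ext (congrFun h' i0)
    · rintro ⟨⟨g, hg⟩, ⟨c, hcg⟩⟩
      have hcg : dg c = g := hcg
      subst hcg
      exact ⟨⟨c, (hc c).2 hg⟩, rfl⟩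
  have hXc : Nat.card Xproj = Nat.card (GG ⧸ N) := by
    symm
    let φ : GG → Xproj := fun g => ⟨Projectivization.mk K (co g.1) (hco0 g.1), (hXp _).2 ⟨g.1, g.2, rfl⟩⟩
    have hφ : ∀ a b : GG, φ a = φ b ↔ a⁻¹ * b ∈ N := by
      intro a b
      rw [eq_comm, Subtype.ext_iff, Projectivization.mk_eq_mk_iff]
      constructor
      · rintro ⟨c, hc⟩
        refine ⟨c, ?_⟩
        funext i
        have := congrFun hc i
        change c = (a.1 i)⁻¹ * b.1 i
        rw [eq_inv_mul_iff_mul_eq, mul_comm]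
        exact Units.ext this
      · rintro ⟨c, hc⟩
        refine ⟨c, ?_⟩
        funext i
        have h : c = (a.1 i)⁻¹ * b.1 i := congrFun hc i
        rw [eq_inv_mul_iff_mul_eq, mul_comm] at h
        exact congrArg Units.val h
    refine Nat.card_congr (Equiv.ofBijective
      (Quotient.lift φ fun a b h => (hφ a b).2 (QuotientGroup.leftRel_apply.1 h)) ⟨?_, ?_⟩)
    · intro a b
      induction a using Quotient.inductionOn with | _ a
      induction b using Quotient.inductionOn with | _ b
      intro h
      exact Quotient.sound (QuotientGroup.leftRel_apply.2 ((hφ a b).1 h))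
    · rintro ⟨P, hP⟩
      obtain ⟨g, hg, rfl⟩ := (hXp P).1 hP
      exact ⟨Quotient.mk _ ⟨g, hg⟩, rfl⟩
  have h2 : Nat.card Xproj = (∏ i, d i) / Finset.univ.gcd d := by
    have h := N.card_eq_card_quotient_mul_card_subgroup
    rw [hGG, hN, ← hXc] at h
    rw [h, Nat.mul_div_cancel]
    rw [← hN]
    exact Nat.card_pos
  refine ⟨h1, h2, ?_⟩
  rw [← h2]
  have : Finite Xproj := by
    apply Nat.finite_of_card_ne_zero
    rw [hXc]
    exact Nat.card_pos.ne'
  have hrep : ∀ P ∈ Xproj, P.rep i0 ≠ 0 := by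
    intro P hP
    obtain ⟨g, hg, rfl⟩ := (hXp P).1 hP
    obtain ⟨a, ha⟩ := Projectivization.exists_smul_eq_mk_rep K (co g) (hco0 g)
    rw [← ha]
    exact mul_ne_zero a.ne_zero (g i0).ne_zero
  have hHm : ∀ m, Nat.card Xproj ≤ m → H m = Nat.card Xproj := by
    intro m hm
    have := Fintype.ofFinite Xproj
    let ev : homogeneousSubmodule (Fin n) K m →ₗ[K] (Xproj → K) :=
      (LinearMap.pi fun P : Xproj => (aeval (R := K) P.1.rep).toLinearMap) ∘ₗ
        (homogeneousSubmodule (Fin n) K m).subtype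
    have hev : ∀ f P, ev f P = eval P.1.rep f.1 := by
      intro f P
      simp [ev, aeval_eq_eval]
    have hker : Submodule.comap (homogeneousSubmodule (Fin n) K m).subtype
          (Submodule.restrictScalars K IX) = LinearMap.ker ev := by
      ext f
      rw [Submodule.mem_comap, Submodule.restrictScalars_mem, LinearMap.mem_ker,
        Submodule.subtype_apply]
      have hf : f.1.IsHomogeneous m := f.2
      constructor
      · intro h
        have hv0 : ∀ x : Fin n → Kˣ, eval (fun i => (x i : K) ^ v i) f.1 = 0 := by
          intro x
          have hle : IX ≤ RingHom.ker (eval (fun i => (x i : K) ^ v i)) := by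
            rw [hIX, Ideal.span_le]
            rintro q ⟨_, hq⟩
            exact hq x
          exact hle h
        funext ⟨P, hP⟩
        rw [hev]
        obtain ⟨g, hg, rfl⟩ := (hXp P).1 hP
        obtain ⟨y, rfl⟩ := hmem' g hg
        obtain ⟨a, ha⟩ := Projectivization.exists_smul_eq_mk_rep K _ (hco0 fun i => y i ^ v i)
        change eval (Projectivization.rep _) f.1 = 0
        rw [← ha, ← hcopow, Units.smul_def, aux_eval_smul hf, hv0, mul_zero]
      · intro h
        rw [hIX]
        refine Ideal.subset_span ⟨⟨m, hf⟩, fun y => ?_⟩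
        rw [hcopow]
        have hP := (hXp _).2 ⟨_, hmem y, rfl⟩
        have h0 := congrFun h ⟨_, hP⟩
        rw [hev] at h0
        obtain ⟨a, ha⟩ := Projectivization.exists_smul_eq_mk_rep K _ (hco0 fun i => y i ^ v i)
        change eval (Projectivization.rep _) f.1 = 0 at h0
        rw [← ha, Units.smul_def, aux_eval_smul hf] at h0
        exact (mul_eq_zero.1 h0).resolve_left (pow_ne_zero _ a.ne_zero)
    have hsurj : Function.Surjective ev := by
      intro g
      obtain ⟨f, hf, hfg⟩ := aux_surj Xproj i0 hrep m hm g
      exact ⟨⟨f, hf⟩, funext fun P => by rw [hev, ← hfg P]⟩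
    rw [hH, hker, (ev.quotKerEquivOfSurjective hsurj).finrank_eq, Module.finrank_fintype_fun_eq_card,
      Nat.card_eq_fintype_card]
  obtain ⟨M, hM⟩ := hp
  have hpC : p = Polynomial.C (Nat.card Xproj : ℚ) := by
    apply Polynomial.eq_of_infinite_eval_eq
    refine Set.Infinite.mono ?_ ((Set.Ici_infinite (max M (Nat.card Xproj))).image
      (f := fun k : ℕ => (k : ℚ)) Nat.cast_injective.injOn)
    rintro _ ⟨k, hk, rfl⟩
    have hk' := max_le_iff.1 (Set.mem_Ici.1 hk)
    simp only [Set.mem_setOf_eq, Polynomial.eval_C]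
    rw [← hM k hk'.1, hHm k hk'.2]
  rw [hpC, Polynomial.coeff_C_zero]
end

section
/- Assume gcd(d_1, …, d_n) = 1 and let I′ = (t_i^{c_{ij}} − t_j^{c_{ij}} : 1 ≤ i < j ≤ n) ⊆ S, where c_{ij} = lcm(d_i, d_j). Then the vanishing ideal I(X) equals the saturation (I′ : (t_1 ⋯ t_n)^∞). -/
open MvPolynomial

lemma grp_aux {G : Type*} [CommGroup G] {n : ℕ} (d : Fin n → ℕ)
    (hgcd : Finset.univ.gcd d = 1) (u : Fin n → G)
    (hu : ∀ i j, u i ^ Nat.lcm (d i) (d j) = u j ^ Nat.lcm (d i) (d j))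
    (a : Fin n → ℤ) (ha : ∀ i, (d i : ℤ) ∣ a i) (hs : ∑ i, a i = 0) :
    ∏ i, u i ^ a i = 1 := by
  rw [← orderOf_eq_one_iff, ← Nat.dvd_one, ← hgcd]
  refine Finset.dvd_gcd fun j _ => orderOf_dvd_of_pow_eq_one ?_
  rw [← Finset.prod_pow]
  have h : ∀ i, (u i ^ a i) ^ d j = (u j ^ d j) ^ a i := by
    intro i
    obtain ⟨b, hb⟩ := ha i
    obtain ⟨e, he⟩ : Nat.lcm (d i) (d j) ∣ d i * d j := Nat.lcm_dvd_mul _ _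
    have h1 : u i ^ (d i * d j) = u j ^ (d i * d j) := by
      rw [he, pow_mul, pow_mul, hu]
    calc (u i ^ a i) ^ d j = (u i ^ (d i * d j)) ^ b := by
          rw [hb, ← zpow_natCast, ← zpow_natCast, ← zpow_mul, ← zpow_mul]
          congr 1; push_cast; ring
      _ = (u j ^ d j) ^ a i := by
          rw [h1, hb, ← zpow_natCast, ← zpow_natCast, ← zpow_mul, ← zpow_mul]
          congr 1; push_cast; ring
  rw [Finset.prod_congr rfl fun i _ => h i]
  have h2 : ∀ (g : G) (s : Finset (Fin n)), ∏ i ∈ s, g ^ a i = g ^ ∑ i ∈ s, a i := by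
    intro g s
    induction s using Finset.induction_on with
    | empty => simp
    | insert i s hi ih => rw [Finset.prod_insert hi, Finset.sum_insert hi, ih, zpow_add]
  rw [h2, hs, zpow_zero]

/-- The character attached to a monomial. -/
noncomputable def chiMon {K : Type*} [Field K] {n : ℕ} (v : Fin n → ℕ) (m : Fin n →₀ ℕ) :
    (Fin n → Kˣ) →* K where
  toFun x := ∏ i, ((x i : K) ^ v i) ^ m i
  map_one' := by simp
  map_mul' x y := by simp [mul_pow, Finset.prod_mul_distrib]

lemma chiMon_eq {K : Type*} [Field K] {n : ℕ} (v : Fin n → ℕ) (β : Kˣ) (m m' : Fin n →₀ ℕ)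
    (h : chiMon (K := K) v m = chiMon v m') (i : Fin n) :
    (orderOf (β ^ v i) : ℤ) ∣ (m i : ℤ) - m' i := by
  have h1 := DFunLike.congr_fun h (Pi.mulSingle i β)
  have key : ∀ m : Fin n →₀ ℕ, chiMon (K := K) v m (Pi.mulSingle i β)
      = (((β ^ v i) ^ m i : Kˣ) : K) := by
    intro m
    change ∏ j, (((Pi.mulSingle i β : Fin n → Kˣ) j : K) ^ v j) ^ m j = _
    rw [Finset.prod_eq_single i]
    · simp
    · intro j _ hj; simp [Pi.mulSingle_eq_of_ne hj]
    · simp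
  rw [key, key, Units.val_inj, pow_eq_pow_iff_modEq] at h1
  exact (Nat.modEq_iff_dvd.mp h1.symm)

lemma fiber_sum {K : Type*} [Field K] {n : ℕ} (v : Fin n → ℕ)
    (f : MvPolynomial (Fin n) K)
    (hf : ∀ x : Fin n → Kˣ, eval (fun i => (x i : K) ^ v i) f = 0)
    {R : Type*} [CommRing R] (φ : MvPolynomial (Fin n) K →+* R)
    (hF : ∀ m ∈ f.support, ∀ m' ∈ f.support, chiMon (K := K) v m = chiMon v m' →
      φ (monomial m 1) = φ (monomial m' 1)) : φ f = 0 := by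
  classical
  have hB : ∀ ψ ∈ f.support.image (chiMon (K := K) v),
      ∑ m ∈ f.support with chiMon (K := K) v m = ψ, coeff m f = 0 := by
    refine linearIndependent_iff'.mp (linearIndependent_monoidHom (Fin n → Kˣ) K)
      (f.support.image (chiMon (K := K) v))
      (fun ψ => ∑ m ∈ f.support with chiMon (K := K) v m = ψ, coeff m f) ?_
    ext x
    have h := hf x
    rw [eval_eq', ← Finset.sum_fiberwise_of_maps_to (t := f.support.image (chiMon (K := K) v))
      (g := chiMon (K := K) v) (fun m hm => Finset.mem_image_of_mem _ hm)] at h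
    rw [Finset.sum_apply, Pi.zero_apply, ← h]
    refine Finset.sum_congr rfl fun ψ _ => ?_
    rw [Pi.smul_apply, smul_eq_mul, Finset.sum_mul]
    refine Finset.sum_congr rfl fun m hm => ?_
    rw [← (Finset.mem_filter.mp hm).2]
    rfl
  rw [f.as_sum, map_sum, ← Finset.sum_fiberwise_of_maps_to
    (t := f.support.image (chiMon (K := K) v))
      (g := chiMon (K := K) v) (fun m hm => Finset.mem_image_of_mem _ hm)]
  refine Finset.sum_eq_zero fun ψ hψ => ?_
  have hz := hB ψ hψ
  obtain ⟨m0, hm0, rfl⟩ := Finset.mem_image.mp hψ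
  have : ∀ m ∈ f.support.filter (fun m => chiMon (K := K) v m = chiMon v m0),
      φ (monomial m (coeff m f)) = φ (C (coeff m f)) * φ (monomial m0 1) := by
    intro m hm
    obtain ⟨h1, h2⟩ := Finset.mem_filter.mp hm
    rw [← hF m h1 m0 hm0 h2, ← map_mul, C_mul_monomial, mul_one]
  rw [Finset.sum_congr rfl this, ← Finset.sum_mul, ← map_sum, ← map_sum, hz]
  simp

/-- **Proposition.** Let `K = 𝔽_q`, `β` a generator of `Kˣ`, `v i > 0`,
`d i = orderOf (β ^ v i)`, and let `IX` be the vanishing ideal of the degenerate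
projective torus parameterized by `x_i ^ v_i`.  Let
`I' = (t_i^{c_{ij}} - t_j^{c_{ij}} : i < j)` with `c_{ij} = lcm (d i) (d j)`.
If `gcd(d 1, …, d n) = 1`, then `IX` is the saturation `(I' : (t_1 ⋯ t_n)^∞)`, i.e.
`f ∈ IX` iff `f * (t_1 ⋯ t_n)^k ∈ I'` for some `k ≥ 1`. -/
theorem vanishing_ideal_eq_saturation
    (K : Type) [Field K] [Fintype K] (n : ℕ) (hn : 2 ≤ n)
    (v : Fin n → ℕ) (hv : ∀ i, 0 < v i)
    (β : Kˣ) (hβ : ∀ x : Kˣ, x ∈ Subgroup.zpowers β)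
    (d : Fin n → ℕ) (hd : ∀ i, d i = orderOf (β ^ v i))
    (hgcd : Finset.univ.gcd d = 1)
    (IX : Ideal (MvPolynomial (Fin n) K))
    (hIX : IX = Ideal.span {f : MvPolynomial (Fin n) K |
      (∃ e, f.IsHomogeneous e) ∧
      ∀ x : Fin n → Kˣ, eval (fun i => (x i : K) ^ v i) f = 0})
    (I' : Ideal (MvPolynomial (Fin n) K))
    (hI' : I' = Ideal.span {f : MvPolynomial (Fin n) K | ∃ i j : Fin n, i < j ∧
      f = X i ^ Nat.lcm (d i) (d j) - X j ^ Nat.lcm (d i) (d j)}) :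
    ∀ f : MvPolynomial (Fin n) K,
      f ∈ IX ↔ ∃ k : ℕ, 1 ≤ k ∧ f * (∏ i, X i) ^ k ∈ I' := by
  classical
  have hIhom : ∀ i j : Fin n, X i ^ Nat.lcm (d i) (d j) - X j ^ Nat.lcm (d i) (d j) ∈ I' := by
    intro i j
    rcases lt_trichotomy i j with h | h | h
    · rw [hI']; exact Ideal.subset_span ⟨i, j, h, rfl⟩
    · subst h; simp
    · rw [← neg_sub, hI', Nat.lcm_comm]
      exact neg_mem (Ideal.subset_span ⟨j, i, h, rfl⟩)
  set P : MvPolynomial (Fin n) K := ∏ i, X i with hP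
  let Q := MvPolynomial (Fin n) K ⧸ I'
  let p : Q := Ideal.Quotient.mk I' P
  let R := Localization.Away p
  let φ : MvPolynomial (Fin n) K →+* R := (algebraMap Q R).comp (Ideal.Quotient.mk I')
  have hφ : ∀ f, φ f = 0 ↔ ∃ k : ℕ, 1 ≤ k ∧ f * P ^ k ∈ I' := by
    intro f
    change algebraMap Q R (Ideal.Quotient.mk I' f) = 0 ↔ _
    rw [IsLocalization.map_eq_zero_iff (Submonoid.powers p)]
    constructor
    · rintro ⟨⟨_, k, rfl⟩, hk⟩
      refine ⟨k + 1, by omega, ?_⟩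
      have h1 : f * P ^ k ∈ I' := by
        rw [← Ideal.Quotient.eq_zero_iff_mem, map_mul, map_pow, mul_comm]; exact hk
      rw [pow_succ, ← mul_assoc]
      exact I'.mul_mem_right _ h1
    · rintro ⟨k, -, hk⟩
      refine ⟨⟨p ^ k, k, rfl⟩, ?_⟩
      rw [← Ideal.Quotient.eq_zero_iff_mem, map_mul, map_pow, mul_comm] at hk
      exact hk
  intro f
  rw [← hφ]
  constructor
  · intro hf
    rw [← RingHom.mem_ker]
    revert f
    change IX ≤ RingHom.ker φ
    rw [hIX, Ideal.span_le]
    rintro f ⟨⟨e, he⟩, hf⟩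
    change φ f = 0
    have hunit : ∀ i, IsUnit (φ (X i)) := by
      intro i
      have : IsUnit (φ P) := IsLocalization.Away.algebraMap_isUnit p
      refine isUnit_of_dvd_unit (map_dvd φ ?_) this
      exact Finset.dvd_prod_of_mem _ (Finset.mem_univ i)
    choose u hu using hunit
    have huu : ∀ i j, u i ^ Nat.lcm (d i) (d j) = u j ^ Nat.lcm (d i) (d j) := by
      intro i j
      apply Units.ext
      push_cast
      rw [hu, hu, ← sub_eq_zero, ← map_pow, ← map_pow, ← map_sub]
      change algebraMap Q R (Ideal.Quotient.mk I' _) = 0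
      rw [Ideal.Quotient.eq_zero_iff_mem.mpr (hIhom i j), map_zero]
    have hmon : ∀ m : Fin n →₀ ℕ, φ (monomial m 1) = ((∏ i, u i ^ m i : Rˣ) : R) := by
      intro m
      rw [monomial_eq, C_1, one_mul, Finsupp.prod_fintype _ _ (fun i => pow_zero _), map_prod]
      push_cast
      exact Finset.prod_congr rfl fun i _ => by rw [map_pow, hu]
    refine fiber_sum v f hf φ fun m hm m' hm' hc => ?_
    rw [hmon, hmon, Units.val_inj, ← div_eq_one, ← Finset.prod_div_distrib]
    rw [← grp_aux d hgcd u huu (fun i => (m i : ℤ) - m' i)]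
    · exact Finset.prod_congr rfl fun i _ => by rw [zpow_sub, zpow_natCast, zpow_natCast, div_eq_mul_inv]
    · intro i; rw [hd]; exact chiMon_eq v β m m' hc i
    · have key : ∀ m ∈ f.support, ∑ i, m i = e := by
        intro m hm
        have := he (mem_support_iff.mp hm)
        rw [← this, Finsupp.weight_apply, Finsupp.sum_fintype _ _ (by simp)]
        simp
      rw [Finset.sum_sub_distrib, ← Nat.cast_sum, ← Nat.cast_sum, key m hm, key m' hm', sub_self]
  · intro hf
    rw [hφ] at hf
    obtain ⟨k, -, hk⟩ := hf
    rw [← sum_homogeneousComponent f, hIX]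
    refine sum_mem fun e _ => Ideal.subset_span ⟨⟨e, homogeneousComponent_isHomogeneous e f⟩, ?_⟩
    intro x
    let θ : MvPolynomial (Fin n) K →+* Polynomial K :=
      eval₂Hom Polynomial.C (fun i => Polynomial.C ((x i : K) ^ v i) * Polynomial.X)
    have hθI : I' ≤ RingHom.ker θ := by
      rw [hI', Ideal.span_le]
      rintro _ ⟨i, j, -, rfl⟩
      have hx : ∀ i, ∀ c, d i ∣ c → ((x i : K) ^ v i) ^ c = 1 := by
        rintro i c ⟨c, rfl⟩
        obtain ⟨z, hz⟩ := hβ (x i)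
        have : ((x i) ^ v i) ^ d i = 1 := by
          simp only at hz
          rw [← hz, ← zpow_natCast (β ^ z), ← zpow_mul, mul_comm z, zpow_mul, zpow_natCast,
            ← zpow_natCast, ← zpow_mul, mul_comm z, zpow_mul, zpow_natCast, hd, pow_orderOf_eq_one,
            one_zpow]
        rw [pow_mul]
        have h2 := congrArg (Units.val) this
        push_cast at h2
        rw [h2, one_pow]
      change θ _ = 0
      rw [map_sub, map_pow, map_pow]
      simp only [θ, coe_eval₂Hom, eval₂_X]
      rw [mul_pow, mul_pow, ← Polynomial.C_pow (n := Nat.lcm _ _), ← Polynomial.C_pow (n := Nat.lcm _ _),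
        hx i _ (Nat.dvd_lcm_left _ _), hx j _ (Nat.dvd_lcm_right _ _), sub_self]
    have hθP : θ P ≠ 0 := by
      rw [hP, map_prod, Finset.prod_ne_zero_iff]
      intro i _
      simp [θ]
    have hθf : θ f = 0 := by
      have := hθI hk
      rw [RingHom.mem_ker, map_mul, map_pow] at this
      exact (mul_eq_zero.mp this).resolve_right (pow_ne_zero _ hθP)
    have hcomp : ∀ m : Fin n →₀ ℕ, ∀ c : K, θ (monomial m c)
        = Polynomial.monomial m.degree (eval (fun i => (x i : K) ^ v i) (monomial m c)) := by
      intro m c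
      simp only [θ, coe_eval₂Hom, eval₂_monomial, eval_monomial]
      rw [← Polynomial.C_mul_X_pow_eq_monomial, Finsupp.prod_fintype _ _ (fun i => pow_zero _),
        Finsupp.prod_fintype _ _ (fun i => pow_zero _)]
      simp only [mul_pow, Finset.prod_mul_distrib, Finset.prod_pow_eq_pow_sum,
        Finsupp.degree_eq_sum, map_mul, map_prod, map_pow]
      ring
    have hco := congrArg (fun q => Polynomial.coeff q e) hθf
    simp only [Polynomial.coeff_zero] at hco
    rw [← hco, homogeneousComponent_apply, map_sum]
    conv_rhs => rw [f.as_sum, map_sum, Polynomial.finsetSum_coeff]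
    rw [Finset.sum_filter]
    refine Finset.sum_congr rfl fun m _ => ?_
    rw [hcomp, Polynomial.coeff_monomial]
end
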